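/- Fix reals ζ > 0 and c > 0. For t > 0 let X(t), Y(t) be independent, X(t) exponential with mean t and Y(t) exponential with mean c·t. Then P( X(t)/(Y(t) + 1) ≤ ζ ) converges as t → ∞ to c·ζ/(1 + c·ζ) = ζ/(1/c + ζ). -/

import Mathlib

open MeasureTheory ProbabilityTheory Real Filter Finset Topology

/-- `X` is exponentially distributed with mean `γ` under `μ`:
`P(X > x) = exp (-x/γ)` for all `x ≥ 0`. -/
def IsExpMean {Ω : Type*} [MeasurableSpace Ω] (μ : Measure Ω) (X : Ω → ℝ) (γ : ℝ) : Prop :=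
  ∀ x : ℝ, 0 ≤ x → μ {ω | x < X ω} = ENNReal.ofReal (Real.exp (-x / γ))

namespace IsExpMean

variable {Ω : Type*} [MeasurableSpace Ω] {μ : Measure Ω} [IsProbabilityMeasure μ]
  {X : Ω → ℝ} {a : ℝ}

theorem ae_pos (hX : IsExpMean μ X a) (hXm : Measurable X) : ∀ᵐ ω ∂μ, 0 < X ω := by
  change μ {ω | 0 < X ω}ᶜ = 0
  rw [prob_compl_eq_zero_iff (measurableSet_lt measurable_const hXm), hX 0 le_rfl]
  simp

theorem map_eq_expMeasure (hX : IsExpMean μ X a) (hXm : Measurable X) (ha : 0 < a) :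
    μ.map X = expMeasure a⁻¹ := by
  have hr : 0 < a⁻¹ := inv_pos.2 ha
  have := isProbabilityMeasure_expMeasure hr
  have := Measure.isProbabilityMeasure_map (μ := μ) hXm.aemeasurable
  refine Measure.eq_of_cdf _ _ (StieltjesFunction.ext fun x ↦ ?_)
  have hset : X ⁻¹' Set.Iic x = {ω | x < X ω}ᶜ := by ext; simp
  rw [cdf_expMeasure_eq hr, cdf_eq_real, map_measureReal_apply hXm measurableSet_Iic, hset]
  split_ifs with h
  · rw [probReal_compl_eq_one_sub (measurableSet_lt measurable_const hXm), measureReal_def, hX x h,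
      ENNReal.toReal_ofReal (exp_pos _).le]
    congr 2
    ring
  · have : {ω | x < X ω}ᶜ ⊆ {ω | 0 < X ω}ᶜ := by
      intro ω hω
      simp only [Set.mem_compl_iff, Set.mem_ofPred_eq, not_lt] at *
      linarith
    rw [measureReal_def, measure_mono_null this (hX.ae_pos hXm), ENNReal.toReal_zero]

end IsExpMean

theorem lintegral_exp_neg_mul_expMeasure {r s : ℝ} (hr : 0 < r) (hs : 0 ≤ s) :
    ∫⁻ y, ENNReal.ofReal (exp (-(s * y))) ∂expMeasure r = ENNReal.ofReal (r / (r + s)) := by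
  have hrs : 0 < r + s := by positivity
  have hpdf : Measurable (exponentialPDF r) :=
    (measurable_exponentialPDFReal r).ennreal_ofReal
  have key (y : ℝ) : exponentialPDF r y * ENNReal.ofReal (exp (-(s * y))) =
      ENNReal.ofReal (r / (r + s)) * exponentialPDF (r + s) y := by
    rw [exponentialPDF_eq, exponentialPDF_eq, ← ENNReal.ofReal_mul (by split_ifs <;> positivity),
      ← ENNReal.ofReal_mul (by positivity)]
    split_ifs
    · rw [mul_assoc, ← exp_add, ← mul_assoc, div_mul_cancel₀ _ hrs.ne']
      ring_nf
    · simp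
  change ∫⁻ y, _ ∂(volume.withDensity (exponentialPDF r)) = _
  rw [lintegral_withDensity_eq_lintegral_mul _ hpdf (by fun_prop)]
  simp only [Pi.mul_apply, key]
  rw [lintegral_const_mul' _ _ ENNReal.ofReal_ne_top, lintegral_exponentialPDF_eq_one hrs, mul_one]

/-- The probability that the ratio `X / (Y + 1)` of independent exponential variables with means
`a` and `b` is at most `ζ`. -/
theorem IsExpMean.measure_div_add_one_le {Ω : Type*} [MeasurableSpace Ω] {μ : Measure Ω}
    [IsProbabilityMeasure μ] {X Y : Ω → ℝ} {a b ζ : ℝ}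
    (hX : IsExpMean μ X a) (hY : IsExpMean μ Y b) (hXm : Measurable X) (hYm : Measurable Y)
    (hXY : IndepFun X Y μ) (ha : 0 < a) (hb : 0 < b) (hζ : 0 ≤ ζ) :
    (μ {ω | X ω / (Y ω + 1) ≤ ζ}).toReal = 1 - exp (-ζ / a) / (1 + b * ζ / a) := by
  have hS : MeasurableSet {p : ℝ × ℝ | ζ * (p.2 + 1) < p.1} :=
    measurableSet_lt (by fun_prop) (by fun_prop)
  have hgt : μ {ω | ζ * (Y ω + 1) < X ω} =
      ENNReal.ofReal (exp (-ζ / a) / (1 + b * ζ / a)) := by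
    have := Measure.isProbabilityMeasure_map (μ := μ) hXm.aemeasurable
    have := Measure.isProbabilityMeasure_map (μ := μ) hYm.aemeasurable
    have hprod := (indepFun_iff_map_prod_eq_prod_map_map hXm.aemeasurable hYm.aemeasurable).1 hXY
    calc μ {ω | ζ * (Y ω + 1) < X ω}
        = (μ.map fun ω ↦ (X ω, Y ω)) {p : ℝ × ℝ | ζ * (p.2 + 1) < p.1} := by
          rw [Measure.map_apply (hXm.prodMk hYm) hS]; rfl
      _ = ∫⁻ y, μ.map X {x | ζ * (y + 1) < x} ∂(μ.map Y) := by
          rw [hprod, Measure.prod_apply_symm hS]; rfl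
      _ = ∫⁻ y, ENNReal.ofReal (exp (-ζ / a)) * ENNReal.ofReal (exp (-(ζ / a * y)))
            ∂(μ.map Y) := by
          refine lintegral_congr_ae ?_
          have hpos : ∀ᵐ y ∂(μ.map Y), 0 < y :=
            (ae_map_iff hYm.aemeasurable measurableSet_Ioi).2 (hY.ae_pos hYm)
          filter_upwards [hpos] with y hy
          change μ.map X (Set.Ioi (ζ * (y + 1))) = _
          rw [Measure.map_apply hXm measurableSet_Ioi]
          change μ {ω | ζ * (y + 1) < X ω} = _
          rw [hX _ (by positivity), ← ENNReal.ofReal_mul (exp_pos _).le, ← exp_add]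
          congr 2
          ring
      _ = _ := by
          rw [lintegral_const_mul' _ _ ENNReal.ofReal_ne_top, hY.map_eq_expMeasure hYm hb,
            lintegral_exp_neg_mul_expMeasure (inv_pos.2 hb) (by positivity),
            ← ENNReal.ofReal_mul (exp_pos _).le]
          congr 1
          field_simp
  have hcongr : μ {ω | X ω / (Y ω + 1) ≤ ζ} = μ {ω | ζ * (Y ω + 1) < X ω}ᶜ := by
    refine measure_congr ?_
    filter_upwards [hY.ae_pos hYm] with ω hω
    refine propext ?_
    change X ω / (Y ω + 1) ≤ ζ ↔ ¬ ζ * (Y ω + 1) < X ω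
    rw [not_lt, div_le_iff₀ (by linarith)]
  rw [hcongr, ← measureReal_def,
    probReal_compl_eq_one_sub (measurableSet_lt (by fun_prop) hXm), measureReal_def, hgt,
    ENNReal.toReal_ofReal (by positivity)]

theorem stmt_5 {Ω : Type*} [MeasurableSpace Ω] (μ : Measure Ω) [IsProbabilityMeasure μ]
    (ζ c : ℝ) (hζ : 0 < ζ) (hc : 0 < c)
    (X Y : ℝ → Ω → ℝ)
    (hXm : ∀ t, 0 < t → Measurable (X t)) (hYm : ∀ t, 0 < t → Measurable (Y t))
    (hX : ∀ t, 0 < t → IsExpMean μ (X t) t)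
    (hY : ∀ t, 0 < t → IsExpMean μ (Y t) (c * t))
    (hindep : ∀ t, 0 < t → IndepFun (X t) (Y t) μ) :
    Tendsto (fun t => (μ {ω | X t ω / (Y t ω + 1) ≤ ζ}).toReal) atTop
      (𝓝 (c * ζ / (1 + c * ζ))) ∧
    c * ζ / (1 + c * ζ) = ζ / (1 / c + ζ) := by
  have hne : 1 + c * ζ ≠ 0 := by positivity
  refine ⟨?_, by field_simp⟩
  have hlim : Tendsto (fun t : ℝ ↦ 1 - exp (-ζ / t) / (1 + c * ζ)) atTop
      (𝓝 (c * ζ / (1 + c * ζ))) := by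
    have h0 : Tendsto (fun t : ℝ ↦ -ζ / t) atTop (𝓝 0) := tendsto_const_nhds.div_atTop tendsto_id
    have h1 := (((continuous_exp.tendsto 0).comp h0).div_const (1 + c * ζ)).const_sub 1
    convert! h1 using 2
    rw [exp_zero]
    field_simp
    ring
  refine hlim.congr' ?_
  filter_upwards [eventually_gt_atTop 0] with t ht
  rw [(hX t ht).measure_div_add_one_le (hY t ht) (hXm t ht) (hYm t ht) (hindep t ht) ht
    (mul_pos hc ht) hζ.le]
  congr 3
  field_simp
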